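/- arXiv:2006.04521 — 9 statements merged into one kernel-verified Lean document; each statement's English description precedes it below -/
import Mathlib

section
/- Let R be a prime ring, I a nonzero (two-sided) ideal of R, and n a fixed positive integer. If the commutator [x^n, y^n] lies in the center Z(R) for all x, y ∈ I, then R is commutative. -/
/-- In a prime ring, `a I b = 0` for a nonzero ideal `I` forces `a = 0` or `b = 0`. -/
lemma eq_zero_or_eq_zero_of_forall_mem_ideal {R : Type*} [Ring R]
    (hprime : ∀ a b : R, (∀ r : R, a * r * b = 0) → a = 0 ∨ b = 0)
    (I : TwoSidedIdeal R) (hI : ∃ x : R, x ∈ I ∧ x ≠ 0) {a b : R}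
    (h : ∀ t ∈ I, a * t * b = 0) : a = 0 ∨ b = 0 := by
  obtain ⟨i, hi, hi0⟩ := hI
  by_contra! hab
  have key : ∀ s, i * s * b = 0 := fun s =>
    (hprime a (i * s * b) fun r => by
      simpa only [mul_assoc] using
        h (r * (i * s)) (I.mul_mem_left _ _ (I.mul_mem_right _ _ hi))).resolve_left hab.1
  rcases hprime i b key with h | h
  exacts [hi0 h, hab.2 h]

/-- A bounded nil-index lemma: `(u t)^k u = 0` for all `t` in a nonzero ideal of a prime ring
forces `u = 0`. -/
lemma eq_zero_of_forall_mul_pow_mul_eq_zero {R : Type*} [Ring R]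
    (hprime : ∀ a b : R, (∀ r : R, a * r * b = 0) → a = 0 ∨ b = 0)
    (I : TwoSidedIdeal R) (hI : ∃ x : R, x ∈ I ∧ x ≠ 0) (k : ℕ) :
    ∀ u : R, (∀ t ∈ I, (u * t) ^ k * u = 0) → u = 0 := by
  induction k with
  | zero =>
    intro u h
    simpa using h 0 I.zero_mem
  | succ k ih =>
    intro u h
    rcases Nat.eq_zero_or_pos k with rfl | hk
    · simpa using eq_zero_or_eq_zero_of_forall_mem_ideal hprime I hI (a := u) (b := u)
        (by simpa using h)
    refine ih u fun t ht => ?_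
    set v := (u * t) ^ k * u with hv
    refine ih v fun s hs => ?_
    obtain ⟨j, rfl⟩ : ∃ j, k = j + 1 := ⟨k - 1, by omega⟩
    set X := u * t with hX
    set Y := u * (s * X ^ (j + 1)) with hY
    have hXu : X ^ (j + 2) * u = 0 := h t ht
    have hYu : Y ^ (j + 2) * u = 0 := h _ (I.mul_mem_right _ _ hs)
    have hYXu : Y * X * u = 0 := by
      rw [hY, show u * (s * X ^ (j + 1)) * X * u = u * s * (X ^ (j + 1) * X * u) by
        simp only [mul_assoc], ← pow_succ, hXu, mul_zero]
    have hYpow : ∀ n, Y ^ n * u = u * (s * X ^ (j + 1) * u) ^ n := fun n => by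
      rw [hY, mul_pow_mul]
    have expand : ∀ n, ∃ g, (X + Y) ^ (n + 1) * u
        = Y ^ (n + 1) * u + X * (Y ^ n * u) + X * (X * (u * g)) := by
      intro n
      induction n with
      | zero => exact ⟨0, by simp [add_mul, add_comm]⟩
      | succ n ihn =>
        obtain ⟨g, hg⟩ := ihn
        refine ⟨(s * X ^ (j + 1) * u) ^ n + t * (u * g), ?_⟩
        have h1 : Y * (X * (Y ^ n * u)) = 0 := by
          rw [hYpow, ← mul_assoc, ← mul_assoc, hYXu, zero_mul]
        have h2 : Y * (X * (X * (u * g))) = 0 := by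
          rw [show Y * (X * (X * (u * g))) = Y * X * u * (t * (u * g)) by
            simp only [hX, mul_assoc], hYXu, zero_mul]
        have h3 : Y ^ (n + 1 + 1) * u = Y * (Y ^ (n + 1) * u) := by rw [pow_succ', mul_assoc]
        rw [pow_succ', mul_assoc, hg, add_mul, mul_add Y, mul_add Y, h1, h2, h3]
        simp only [mul_add, hYpow, add_zero, hX, mul_assoc]
        abel
    obtain ⟨g, hg⟩ := expand (j + 1)
    have h0 : (X + Y) ^ (j + 1 + 1) * u = 0 := by
      rw [hX, hY, ← mul_add]
      exact h _ (I.add_mem ht (I.mul_mem_right _ _ hs))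
    have h1 : X ^ j * (X * (X * (u * g))) = 0 := by
      rw [← mul_assoc, ← mul_assoc, ← mul_assoc, ← pow_succ, ← pow_succ, hXu, zero_mul]
    have h2 : X ^ (j + 1) * (Y ^ (j + 1) * u) = 0 := by
      have := congrArg (X ^ j * ·) hg
      simp only [h0, hYu, mul_add, h1, mul_zero, zero_add, add_zero] at this
      rw [pow_succ, mul_assoc, ← this]
    rw [mul_pow_mul, hv, ← h2, hYpow]
    simp only [mul_assoc]

/-- A prime ring in which `m`-th powers of elements of a nonzero ideal commute is reduced. -/
lemma eq_zero_of_sq_eq_zero_of_pow_comm {R : Type*} [Ring R]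
    (hprime : ∀ a b : R, (∀ r : R, a * r * b = 0) → a = 0 ∨ b = 0)
    (I : TwoSidedIdeal R) (hI : ∃ x : R, x ∈ I ∧ x ≠ 0) {m : ℕ} (hm : 0 < m)
    (h : ∀ x ∈ I, ∀ y ∈ I, x ^ m * y ^ m = y ^ m * x ^ m) {a : R} (ha : a * a = 0) : a = 0 := by
  obtain ⟨m, rfl⟩ : ∃ k, m = k + 1 := ⟨m - 1, by omega⟩
  refine eq_zero_of_forall_mul_pow_mul_eq_zero hprime I hI (m + 1) a fun r hr => ?_
  set z := (a * r) ^ (m + 1) with hz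
  set b := z * a with hb
  have hba : b * a = 0 := by rw [hb, mul_assoc, ha, mul_zero]
  have hzya : ∀ y ∈ I, z * (y * a) ^ (m + 1) = 0 := fun y hy => by
    rw [hz, h _ (I.mul_mem_left _ _ hr) _ (I.mul_mem_right _ _ hy), pow_succ, pow_succ']
    rw [show (y * a) ^ m * (y * a) * (a * r * (a * r) ^ m)
      = (y * a) ^ m * y * (a * a) * r * (a * r) ^ m by simp only [mul_assoc], ha]
    simp
  have hzwb : ∀ w ∈ I, z * w * (b * w) ^ m * b = 0 := fun w hw => by
    have := hzya (w * z) (I.mul_mem_right _ _ hw)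
    rw [mul_assoc w, ← hb, pow_succ', ← mul_assoc, ← mul_assoc] at this
    rw [mul_assoc, mul_pow_mul]
    simpa only [mul_assoc] using this
  refine eq_zero_of_forall_mul_pow_mul_eq_zero hprime I hI (m + 1) b fun w hw => ?_
  have h1 := hzwb w hw
  have h2 := hzwb (w + a * w) (I.add_mem hw (I.mul_mem_left _ _ hw))
  rw [show b * (w + a * w) = b * w by rw [mul_add, ← mul_assoc, hba]; simp,
    show z * (w + a * w) = z * w + b * w by rw [mul_add, ← mul_assoc], add_mul, add_mul, h1,
    zero_add] at h2
  rwa [pow_succ']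

/-- A reduced prime ring has no zero divisors. -/
lemma eq_zero_or_eq_zero_of_mul_eq_zero_of_reduced {R : Type*} [Ring R]
    (hprime : ∀ a b : R, (∀ r : R, a * r * b = 0) → a = 0 ∨ b = 0)
    (hred : ∀ a : R, a * a = 0 → a = 0) {a b : R} (hab : a * b = 0) : a = 0 ∨ b = 0 := by
  refine (hprime b a fun r => hred _ ?_).symm
  rw [show b * r * a * (b * r * a) = b * r * (a * b) * r * a by simp only [mul_assoc], hab]
  simp

/-- In a prime ring, if the commutators `[x ^ n, y ^ n]` are central on an ideal,
then the `2n`-th powers commute. -/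
lemma pow_two_mul_comm_of_commutator_mem_center {R : Type*} [Ring R]
    (hprime : ∀ a b : R, (∀ r : R, a * r * b = 0) → a = 0 ∨ b = 0)
    (I : TwoSidedIdeal R) {n : ℕ}
    (h : ∀ x ∈ I, ∀ y ∈ I, x ^ n * y ^ n - y ^ n * x ^ n ∈ Set.center R) :
    ∀ x ∈ I, ∀ y ∈ I, x ^ (2 * n) * y ^ (2 * n) = y ^ (2 * n) * x ^ (2 * n) := by
  have key : ∀ x ∈ I, ∀ y ∈ I, Commute (x ^ n) (y ^ n * y ^ n) := by
    intro x hx y hy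
    have hc := h x hx y hy
    have hd := h x hx (y * y) (I.mul_mem_left _ _ hy)
    rw [← pow_two, ← pow_mul, mul_comm 2, pow_mul, pow_two] at hd
    set A := x ^ n
    set B := y ^ n
    set c := A * B - B * A with hcdef
    rw [Semigroup.mem_center_iff] at hc hd
    have hAB : A * B = B * A + c := by rw [hcdef]; abel
    have e1 : A * (B * B) - B * B * A = (c + c) * B := by
      rw [← mul_assoc, hAB, add_mul, mul_assoc, hAB, mul_add, hc, mul_assoc]
      noncomm_ring
    have e2 : (c + c) * c = 0 := by
      have := hd A
      rw [e1] at this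
      have h3 : A * (c + c) = (c + c) * A := by rw [mul_add, add_mul, hc]
      rw [← mul_assoc, h3, mul_assoc, mul_assoc, ← sub_eq_zero, ← mul_sub] at this
      exact this
    have e3 : c + c = 0 := by
      rcases hprime (c + c) c fun r => by rw [mul_assoc, hc, ← mul_assoc, e2, zero_mul] with h | h
      · exact h
      · simp [h]
    rw [e3, zero_mul, sub_eq_zero] at e1
    exact e1
  intro x hx y hy
  have := key x hx y hy
  rw [mul_comm 2, pow_mul, pow_mul, pow_two, pow_two]
  exact (this.mul_left this)

/-- If `a` commutes with all `m`-th powers of elements of an ideal of a domain and `u` does not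
commute with `a`, then `u` commutes with the `m`-th powers of the elements of a left ideal. -/
lemma commute_pow_of_not_commute {R : Type*} [Ring R] [NoZeroDivisors R]
    {I : TwoSidedIdeal R} {m : ℕ} {a u : R} (ha : ∀ x ∈ I, Commute a (x ^ m))
    (hau : ¬ Commute a u) {w : R} (hw : w ∈ I) : Commute u ((w * ((1 + u) * u)) ^ m) := by
  have hcomm : Commute (1 + u) u := (Commute.one_left u).add_left (Commute.refl u)
  set c := (w * ((1 + u) * u)) ^ m with hc
  set c₁ := (u * (w * (1 + u))) ^ m with hc₁
  set c₂ := ((1 + u) * (w * u)) ^ m with hc₂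
  have ac : a * c = c * a := ha _ (I.mul_mem_right _ _ hw)
  have ac₁ : a * c₁ = c₁ * a := ha _ (I.mul_mem_left _ _ (I.mul_mem_right _ _ hw))
  have ac₂ : a * c₂ = c₂ * a := ha _ (I.mul_mem_left _ _ (I.mul_mem_right _ _ hw))
  have uc : c₁ * u = u * c := by rw [hc, hc₁, mul_pow_mul]; simp only [mul_assoc]
  have vc : c₂ * (1 + u) = (1 + u) * c := by
    rw [hc, hc₂, mul_pow_mul, hcomm.eq]; simp only [mul_assoc]
  have h1 : c = c₂ + (c₂ - c₁) * u := by
    have : c + u * c = c₂ + c₂ * u := by simpa [mul_add, add_mul] using vc.symm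
    rw [sub_mul, uc, ← add_sub_assoc, ← this, add_sub_cancel_right]
  have h2 : (c₂ - c₁) * (a * u - u * a) = 0 := by
    have e1 : a * c = a * c₂ + a * ((c₂ - c₁) * u) := by rw [← mul_add, ← h1]
    have e2 : c * a = c₂ * a + (c₂ - c₁) * u * a := by rw [← add_mul, ← h1]
    have e3 : a * ((c₂ - c₁) * u) = (c₂ - c₁) * (a * u) := by
      rw [← mul_assoc, mul_sub, ac₁, ac₂, ← sub_mul, mul_assoc]
    rw [e3] at e1
    rw [ac, e2, ac₂] at e1
    rw [mul_sub, ← add_left_cancel e1, mul_assoc, sub_self]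
  have h3 : c₂ - c₁ = 0 := (mul_eq_zero.mp h2).resolve_right fun h => hau (sub_eq_zero.mp h)
  rw [h3, zero_mul, add_zero] at h1
  rw [sub_eq_zero] at h3
  rw [← h3, ← h1] at uc
  exact uc.symm

/-- In a domain, if the `m`-th powers of elements of a nonzero ideal commute with each other, then
all `m`-th powers are central. -/
lemma pow_mem_center_of_pow_comm {R : Type*} [Ring R] [NoZeroDivisors R]
    (I : TwoSidedIdeal R) (hI : ∃ x : R, x ∈ I ∧ x ≠ 0) {m : ℕ} (hm : 0 < m)
    (h : ∀ x ∈ I, ∀ y ∈ I, x ^ m * y ^ m = y ^ m * x ^ m) (x y : R) : Commute (x ^ m) y := by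
  obtain ⟨i, hi, hi0⟩ := hI
  suffices hsuff : ∀ x ∈ I, ∀ y ∈ I, Commute (x ^ m) y by
    have hcen : ∀ x ∈ I, ∀ y, Commute (x ^ m) y := fun x hx y => by
      have h1 := hsuff x hx i hi
      have h2 : x ^ m * (i * y) = i * y * x ^ m := hsuff x hx (i * y) (I.mul_mem_right _ _ hi)
      rw [← mul_assoc, h1.eq, mul_assoc, mul_assoc] at h2
      exact mul_left_cancel₀ hi0 h2
    have hz : Commute (i ^ m) x := hcen i hi x
    have hzx : i ^ m * x ∈ I := by
      obtain ⟨k, rfl⟩ : ∃ k, m = k + 1 := ⟨m - 1, by omega⟩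
      exact I.mul_mem_right _ _ (by rw [pow_succ]; exact I.mul_mem_left _ _ hi)
    have h1 : (i ^ m * x) ^ m * y = y * (i ^ m * x) ^ m := hcen _ hzx y
    have h2 : (i ^ m) ^ m * y = y * (i ^ m) ^ m := (hcen i hi y).pow_left m
    rw [hz.mul_pow, ← mul_assoc, ← h2, mul_assoc, mul_assoc] at h1
    exact mul_left_cancel₀ (pow_ne_zero _ (pow_ne_zero _ hi0)) h1
  by_cases hH : ∀ a, (∀ x ∈ I, Commute a (x ^ m)) → ∀ u, Commute a u
  · exact fun x hx y _ => hH _ (fun y hy => h x hx y hy) y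
  push Not at hH
  obtain ⟨a, ha, u₀, hu₀⟩ := hH
  have common : ∀ p q : R, p ≠ 0 → q ≠ 0 → ∃ r ≠ 0, ∃ s ∈ I, ∃ t ∈ I, r = s * p ∧ r = t * q := by
    intro p q hp hq
    have e := h (i * p) (I.mul_mem_right _ _ hi) (i * q) (I.mul_mem_right _ _ hi)
    refine ⟨_, mul_ne_zero (pow_ne_zero m (mul_ne_zero hi0 hp))
      (pow_ne_zero m (mul_ne_zero hi0 hq)), (i * q) ^ m * (i * p) ^ (m - 1) * i,
      I.mul_mem_left _ _ hi, (i * p) ^ m * (i * q) ^ (m - 1) * i, I.mul_mem_left _ _ hi, ?_, ?_⟩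
    · rw [e, mul_assoc, mul_assoc, pow_sub_one_mul hm.ne']
    · rw [mul_assoc, mul_assoc, pow_sub_one_mul hm.ne']
  have hG₀ : ∀ u, ¬ Commute a u → ∃ p : R, p ≠ 0 ∧ ∀ w ∈ I, Commute u ((w * p) ^ m) := by
    intro u hu
    refine ⟨(1 + u) * u, fun h0 => hu ?_, fun w hw => commute_pow_of_not_commute ha hu hw⟩
    rcases mul_eq_zero.mp h0 with h0 | h0
    · rw [eq_neg_of_add_eq_zero_right h0]; exact (Commute.one_right a).neg_right
    · rw [h0]; exact Commute.zero_right a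
  have hG : ∀ u, ∃ p : R, p ≠ 0 ∧ ∀ w, Commute u ((w * p) ^ m) := by
    intro u
    by_cases hu : Commute a u
    · obtain ⟨p, hp, hpc⟩ := hG₀ u₀ hu₀
      obtain ⟨q, hq, hqc⟩ := hG₀ (u + u₀) fun hc => hu₀ (by simpa using hc.sub_right hu)
      obtain ⟨r, hr, s, hs, t, ht, hrs, hrt⟩ := common p q hp hq
      refine ⟨r, hr, fun w => ?_⟩
      have h1 := hpc (w * s) (I.mul_mem_left _ _ hs)
      have h2 := hqc (w * t) (I.mul_mem_left _ _ ht)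
      rw [mul_assoc, ← hrs] at h1
      rw [mul_assoc, ← hrt] at h2
      simpa using h2.sub_left h1
    · obtain ⟨p, hp, hpc⟩ := hG₀ u hu
      exact ⟨i * p, mul_ne_zero hi0 hp, fun w => by
        rw [← mul_assoc]; exact hpc _ (I.mul_mem_left _ _ hi)⟩
  intro u _ v _
  obtain ⟨p, hp, hpc⟩ := hG u
  obtain ⟨q, hq, hqc⟩ := hG v
  obtain ⟨r, hr, s, -, t, -, hrs, hrt⟩ := common p q hp hq
  have h1 : Commute u (r ^ m) := by rw [hrs]; exact hpc s
  have h2 : ∀ w, Commute v ((w * r) ^ m) := fun w => by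
    rw [hrt, ← mul_assoc]; exact hqc _
  have h3 : v * (u ^ m * (r ^ m) ^ m) = u ^ m * (r ^ m) ^ m * v := by
    rw [← h1.mul_pow, ← pow_sub_one_mul hm.ne' r, ← mul_assoc]
    exact h2 _
  have h4 : v * (r ^ m) ^ m = (r ^ m) ^ m * v := by
    have := h2 (r ^ (m - 1))
    rw [pow_sub_one_mul hm.ne'] at this
    exact this
  rw [mul_assoc, ← h4, ← mul_assoc, ← mul_assoc] at h3
  exact (mul_right_cancel₀ (pow_ne_zero _ (pow_ne_zero _ hr)) h3).symm

open Polynomial in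
/-- If a product of factors `T - c` kills a nonzero vector, then some `c` is an eigenvalue. -/
lemma exists_eigenvalue_of_prod {K V : Type*} [Field K] [AddCommGroup V] [Module K V]
    (T : V →ₗ[K] V) (s : Finset K) :
    ∀ v : V, v ≠ 0 → aeval T (∏ c ∈ s, (X - C c)) v = 0 → ∃ c ∈ s, ∃ w : V, w ≠ 0 ∧ T w = c • w := by
  classical
  induction s using Finset.induction_on with
  | empty => intro v hv h; simp [hv] at h
  | insert c s hc ih =>
    intro v hv h
    by_cases hw : aeval T (∏ c ∈ s, (X - C c)) v = 0
    · obtain ⟨d, hd, w, hw⟩ := ih v hv hw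
      exact ⟨d, Finset.mem_insert_of_mem hd, w, hw⟩
    · refine ⟨c, Finset.mem_insert_self _ _, _, hw, ?_⟩
      rw [Finset.prod_insert hc, map_mul, Module.End.mul_apply] at h
      simpa [sub_eq_zero, Module.algebraMap_end_apply] using h

open Polynomial in
/-- Over a finite field `K`, a nonzero operator with `T ^ |K| = T` has a nonzero eigenvalue. -/
lemma exists_eigenvalue_ne_zero_of_pow_card_eq_self {K V : Type*} [Field K] [Fintype K]
    [AddCommGroup V] [Module K V] (T : V →ₗ[K] V) (hT : T ^ Fintype.card K = T) (hT0 : T ≠ 0) :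
    ∃ c : K, c ≠ 0 ∧ ∃ w : V, w ≠ 0 ∧ T w = c • w := by
  classical
  obtain ⟨v, hv⟩ : ∃ v, T v ≠ 0 := by
    by_contra! h
    exact hT0 (LinearMap.ext h)
  have hprod : (X ^ Fintype.card K - X : K[X]) = ∏ c : K, (X - C c) := by
    have h1 := prod_multiset_X_sub_C_of_monic_of_roots_card_eq (p := (X ^ Fintype.card K - X : K[X]))
      (monic_X_pow_sub (by simpa using Fintype.one_lt_card)) (by
        rw [FiniteField.roots_X_pow_card_sub_X, FiniteField.X_pow_card_sub_X_natDegree_eq K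
          Fintype.one_lt_card]; rfl)
    rw [FiniteField.roots_X_pow_card_sub_X] at h1
    exact h1.symm
  rw [← Finset.prod_erase_mul _ _ (Finset.mem_univ 0), C_0, sub_zero] at hprod
  have h2 : aeval T (∏ c ∈ Finset.univ.erase (0 : K), (X - C c)) (T v) = 0 := by
    have := congrArg (fun p => aeval T p v) hprod
    simpa [hT] using this.symm
  obtain ⟨c, hc, w, hw⟩ := exists_eigenvalue_of_prod T _ _ hv h2
  exact ⟨c, Finset.ne_of_mem_erase hc, w, hw⟩

/-- Comparing coefficients of a polynomial identity with enough central arguments. -/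
lemma smul_eq_zero_of_forall_sum_pow_smul_eq_zero {K M : Type*} [CommRing K] [IsDomain K]
    [AddCommGroup M] [Module K M] [Module.IsTorsionFree K M] {n : ℕ} {t : Fin n → K}
    (ht : Function.Injective t) {f : Fin n → M} (h : ∀ j, ∑ i : Fin n, t j ^ (i : ℕ) • f i = 0) :
    f = 0 := by
  set V := Matrix.vandermonde t
  have hdet : V.det ≠ 0 := Matrix.det_vandermonde_ne_zero_iff.mpr ht
  funext i
  have : V.det • f i = 0 := by
    calc V.det • f i = ∑ k, (V.adjugate * V) i k • f k := by
          simp [Matrix.adjugate_mul, Matrix.smul_apply, Matrix.one_apply]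
      _ = ∑ j, V.adjugate i j • ∑ k : Fin n, t j ^ (k : ℕ) • f k := by
          simp only [Matrix.mul_apply, Finset.sum_smul, Finset.smul_sum, smul_smul]
          rw [Finset.sum_comm]
          rfl
      _ = 0 := by simp [h]
  exact (smul_eq_zero.mp this).resolve_left hdet

/-- If `(x + t) ^ N` commutes with `y` for infinitely many central `t`, then
`N • [x, y] = 0`. -/
lemma nsmul_commutator_eq_zero {R : Type*} [Ring R] [IsDomain R] {S : Set (Subring.center R)}
    (hS : S.Infinite) {N : ℕ} {x y : R} (h : ∀ t ∈ S, Commute ((x + t) ^ N) y) :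
    (N : R) * (x * y - y * x) = 0 := by
  rcases Nat.eq_zero_or_pos N with rfl | hN
  · simp
  have : Infinite S := hS.to_subtype
  let t : Fin (N + 1) → Subring.center R := fun j => (Infinite.natEmbedding S j : Subring.center R)
  have ht : Function.Injective t := fun i j hij =>
    Fin.ext ((Infinite.natEmbedding S).injective (Subtype.ext hij))
  have key := smul_eq_zero_of_forall_sum_pow_smul_eq_zero ht
    (f := fun i : Fin (N + 1) => (N.choose i : R) * (x ^ (N - i) * y - y * x ^ (N - i))) fun j => by
      have h1 := h (t j) (Infinite.natEmbedding S j).2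
      have hc : ∀ z : R, z * (t j : R) = t j * z := Subring.mem_center_iff.mp (t j).2
      have hxt : Commute (t j : R) x := (hc x).symm
      rw [add_comm, hxt.add_pow, Commute, SemiconjBy, ← sub_eq_zero, Finset.sum_mul,
        Finset.mul_sum, ← Finset.sum_sub_distrib, Finset.sum_range] at h1
      rw [← h1]
      refine Finset.sum_congr rfl fun i _ => ?_
      have e := fun z : R => Nat.cast_commute (N.choose i) z
      have hcy : Commute (t j ^ (i : ℕ) : R) y := Commute.pow_left (hc y).symm i
      rw [Subring.smul_def, smul_eq_mul, Subring.coe_pow, (e _).eq, sub_mul, mul_sub]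
      congr 1
      · simp only [mul_assoc]
        rw [(e y).eq]
      · rw [← mul_assoc, ← mul_assoc, ← mul_assoc, hcy.eq]
        simp only [mul_assoc]
  have := congrFun key ⟨N - 1, by omega⟩
  simpa [Nat.choose_symm hN, Nat.sub_sub_self hN] using this

/-- In characteristic `p`, the `p ^ k`-th iterate of `[x, ·]` is `[x ^ p ^ k, ·]`. -/
lemma mulLeft_sub_mulRight_pow_char_pow_apply {R : Type*} [Ring R] (p : ℕ) [CharP R p]
    [Fact p.Prime] (k : ℕ) (x y : R) :
    ((LinearMap.mulLeft ℤ x - LinearMap.mulRight ℤ x) ^ p ^ k) y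
      = x ^ p ^ k * y - y * x ^ p ^ k := by
  have : CharP (Module.End ℤ R) p := ⟨fun n => by
    rw [← CharP.cast_eq_zero_iff R p n]
    constructor
    · intro h
      simpa using LinearMap.congr_fun h (1 : R)
    · intro h
      ext z
      simp [h]⟩
  rw [sub_pow_char_pow_of_commute _ _ (LinearMap.commute_mulLeft_right x x)]
  simp [LinearMap.pow_mulLeft, LinearMap.pow_mulRight]

/-- A domain of characteristic `p` whose `p ^ k`-th powers are central is commutative. -/
lemma mul_comm_of_pow_char_pow_mem_center {R : Type*} [Ring R] [IsDomain R] (p : ℕ) [CharP R p]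
    [hp : Fact p.Prime] (k : ℕ) (h : ∀ x y : R, Commute (x ^ p ^ k) y) (x y : R) :
    x * y = y * x := by
  classical
  set D : Module.End ℤ R := LinearMap.mulLeft ℤ x - LinearMap.mulRight ℤ x with hD
  have hDa : ∀ z, D z = x * z - z * x := fun z => by simp [hD]
  have hex : ∃ n, (D ^ n) y = 0 := ⟨p ^ k, by
    rw [hD, mulLeft_sub_mulRight_pow_char_pow_apply, (h x y).eq, sub_self]⟩
  obtain ⟨n, hn, hmin⟩ : ∃ n, (D ^ n) y = 0 ∧ ∀ j < n, (D ^ j) y ≠ 0 :=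
    ⟨Nat.find hex, Nat.find_spec hex, fun j hj => Nat.find_min hex hj⟩
  match n, hn, hmin with
  | 0, hn, _ =>
    have : y = 0 := by simpa using hn
    simp [this]
  | 1, hn, _ => exact sub_eq_zero.mp (by simpa [hDa] using hn)
  | n + 2, hn, hmin =>
    exfalso
    set v := (D ^ n) y
    set b := D v with hb
    have hb0 : b ≠ 0 := by
      have := hmin (n + 1) (by omega)
      rwa [pow_succ', Module.End.mul_apply] at this
    have hxb : x * b = b * x := by
      rw [pow_succ', pow_succ', Module.End.mul_apply, Module.End.mul_apply, hDa (D _)] at hn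
      exact sub_eq_zero.mp hn
    have hq : p ^ k ≠ 0 := pow_ne_zero _ hp.out.ne_zero
    have hxv : x * v = v * x + b := by rw [hb, hDa]; abel
    set β := b ^ p ^ k with hβ
    have hxz : x * (b ^ (p ^ k - 1) * v) = b ^ (p ^ k - 1) * v * x + β := by
      have : x * b ^ (p ^ k - 1) = b ^ (p ^ k - 1) * x := Commute.pow_right hxb _
      rw [← mul_assoc, this, mul_assoc, hxv, mul_add, ← mul_assoc, pow_sub_one_mul hq]
    set z := b ^ (p ^ k - 1) * v * x with hz
    have hconj : x * z = (z + β) * x := by rw [hz, ← mul_assoc, hxz]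
    have hpow : x * z ^ p ^ k = (z + β) ^ p ^ k * x :=
      (SemiconjBy.pow_right (show SemiconjBy x z (z + β) from hconj) _)
    rw [add_pow_char_pow_of_commute p k (h b z).symm, ← (h z x).eq, add_mul, left_eq_add] at hpow
    rcases mul_eq_zero.mp hpow with h0 | h0
    · exact pow_ne_zero _ (pow_ne_zero _ hb0) h0
    · exact hb0 (by rw [hb, hDa, h0]; simp)

/-- A domain with finite center, some positive power of each element of which is central,
is commutative. -/
lemma mul_comm_of_pow_mem_center_of_finite {R : Type*} [Ring R] [IsDomain R]
    [Finite (Subring.center R)] {m : ℕ} (hm : 0 < m) (h : ∀ x y : R, Commute (x ^ m) y) (a y : R) :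
    a * y = y * a := by
  classical
  by_contra hay
  have hord : ∀ x : R, x ≠ 0 → ∃ M, 0 < M ∧ x ^ M = 1 := by
    intro x hx
    have hxm : x ^ m ∈ Subring.center R :=
      Subring.mem_center_iff.mpr fun g => (h x g).symm
    obtain ⟨i, j, hij, hlt⟩ : ∃ i j : ℕ,
        (⟨x ^ m, hxm⟩ : Subring.center R) ^ i = ⟨x ^ m, hxm⟩ ^ j ∧ i < j := by
      obtain ⟨i, j, h1, h2⟩ := Function.not_injective_iff.mp
        (not_injective_infinite_finite fun i : ℕ => (⟨x ^ m, hxm⟩ : Subring.center R) ^ i)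
      rcases lt_or_gt_of_ne h2 with h3 | h3
      exacts [⟨i, j, h1, h3⟩, ⟨j, i, h1.symm, h3⟩]
    have hij' : (x ^ m) ^ i = (x ^ m) ^ j := congrArg Subtype.val hij
    refine ⟨m * (j - i), Nat.mul_pos hm (Nat.sub_pos_of_lt hlt), ?_⟩
    rw [← Nat.add_sub_cancel' hlt.le, pow_add] at hij'
    rw [pow_mul]
    exact (mul_left_cancel₀ (pow_ne_zero i (pow_ne_zero m hx)) (by rw [← hij', mul_one])).symm
  have hfinite : ∀ S : Subalgebra (Subring.center R) R, (Subalgebra.toSubmodule S).FG → Finite S :=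
    fun S hS => by
      have : Module.Finite (Subring.center R) S := Module.Finite.iff_fg.mpr hS
      exact Module.finite_of_finite (Subring.center R)
  obtain ⟨p, hchar⟩ := CharP.exists R
  have hp0 : p ≠ 0 := by
    rintro rfl
    have : CharZero R := CharP.charP_to_charZero R
    exact not_injective_infinite_finite (fun n : ℕ => (n : Subring.center R)) fun i j hij =>
      Nat.cast_injective (R := R) (by simpa using congrArg Subtype.val hij)
  have hp : Fact p.Prime := ⟨(CharP.char_is_prime_or_zero R p).resolve_right hp0⟩
  have ha0 : a ≠ 0 := by rintro rfl; simp at hay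
  let A := Algebra.adjoin (Subring.center R) {a}
  have haA : a ∈ A := Algebra.self_mem_adjoin_singleton _ _
  have hAfin : Finite A := by
    refine hfinite A (IsIntegral.fg_adjoin_singleton ?_)
    obtain ⟨M, hM, haM⟩ := hord a ha0
    exact IsIntegral.of_pow hM (by rw [haM]; exact isIntegral_one)
  have hAcomm : ∀ c ∈ A, a * c = c * a := fun c hc =>
    congrArg Subtype.val ((Finite.isDomain_to_isField A).mul_comm ⟨a, haA⟩ ⟨c, hc⟩)
  let _ : Field A := (Finite.isDomain_to_isField A).toField
  let _ : Fintype A := Fintype.ofFinite A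
  have hcharA : CharP A p := (RingHom.charP_iff A.val.toRingHom Subtype.val_injective p).mpr hchar
  let T : R →ₗ[A] R :=
    { toFun := fun z => a * z - z * a
      map_add' := fun z w => by noncomm_ring
      map_smul' := fun c z => by
        change a * (c * z) - c * z * a = c * (a * z - z * a)
        rw [← mul_assoc, hAcomm c c.2]
        noncomm_ring }
  have hTpow : ∀ n z, (T ^ n) z = ((LinearMap.mulLeft ℤ a - LinearMap.mulRight ℤ a) ^ n) z := by
    intro n
    induction n with
    | zero => intro z; rfl
    | succ n ih =>
      intro z
      rw [pow_succ', pow_succ', Module.End.mul_apply, Module.End.mul_apply, ← ih]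
      rfl
  obtain ⟨c, hc0, b, hb0, hcb⟩ := exists_eigenvalue_ne_zero_of_pow_card_eq_self T (by
      ext z
      obtain ⟨k, -, hk⟩ := FiniteField.card A p
      have haq : a ^ p ^ (k : ℕ) = a := by
        have := congrArg Subtype.val (FiniteField.pow_card (⟨a, haA⟩ : A))
        rw [hk] at this
        exact this
      rw [hTpow, hk, mulLeft_sub_mulRight_pow_char_pow_apply, haq]
      rfl)
    (fun hT => hay (sub_eq_zero.mp (LinearMap.congr_fun hT y)))
  have hcb' : a * b - b * a = c * b := hcb
  have hbA : ∀ x ∈ A, ∃ x' ∈ A, b * x = x' * b := by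
    intro x hx
    induction hx using Algebra.adjoin_induction with
    | mem x hx =>
      obtain rfl : x = a := hx
      exact ⟨x - c, A.sub_mem haA c.2, by rw [sub_mul, ← hcb']; abel⟩
    | algebraMap r => exact ⟨_, A.algebraMap_mem r, (Algebra.commutes r b).symm⟩
    | add x y _ _ hx hy =>
      obtain ⟨x', hx', hx⟩ := hx
      obtain ⟨y', hy', hy⟩ := hy
      exact ⟨_, A.add_mem hx' hy', by rw [mul_add, hx, hy, add_mul]⟩
    | mul x y _ _ hx hy =>
      obtain ⟨x', hx', hx⟩ := hx
      obtain ⟨y', hy', hy⟩ := hy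
      exact ⟨_, A.mul_mem hx' hy', by rw [← mul_assoc, hx, mul_assoc, hy, mul_assoc]⟩
  obtain ⟨M, hM, hbM⟩ := hord b hb0
  have hclosure : (Submonoid.closure {a, b} : Set R) ⊆
      Set.range fun q : A × Fin M => (q.1 : R) * b ^ (q.2 : ℕ) := by
    intro x hx
    induction hx using Submonoid.closure_induction_left with
    | one => exact ⟨(1, ⟨0, hM⟩), by simp⟩
    | mul_left g hg x _ hx =>
      obtain ⟨⟨α, j⟩, rfl⟩ := hx
      rcases hg with rfl | rfl
      · exact ⟨(⟨g, haA⟩ * α, j), by simp [mul_assoc]⟩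
      · obtain ⟨α', hα', e⟩ := hbA α α.2
        refine ⟨(⟨α', hα'⟩, ⟨(j + 1) % M, Nat.mod_lt _ hM⟩), ?_⟩
        change α' * g ^ ((j + 1) % M) = g * (α * g ^ (j : ℕ))
        rw [← mul_assoc, e, mul_assoc, ← pow_succ', ← pow_eq_pow_mod _ hbM]
  have hSfin : Finite (Algebra.adjoin (Subring.center R) {a, b}) := by
    refine hfinite _ ?_
    rw [Algebra.adjoin_eq_span]
    exact Submodule.fg_span ((Set.finite_range _).subset hclosure)
  have hab : a * b = b * a := congrArg Subtype.val
    ((Finite.isDomain_to_isField (Algebra.adjoin (Subring.center R) {a, b})).mul_comm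
      ⟨a, Algebra.subset_adjoin (by simp)⟩ ⟨b, Algebra.subset_adjoin (by simp)⟩)
  rw [hab, sub_self] at hcb'
  rcases mul_eq_zero.mp hcb'.symm with h0 | h0
  exacts [hc0 (Subtype.ext h0), hb0 h0]

/-- A domain all of whose `m`-th powers are central is commutative. -/
lemma mul_comm_of_pow_mem_center {R : Type*} [Ring R] [IsDomain R] {m : ℕ} (hm : 0 < m)
    (h : ∀ x y : R, Commute (x ^ m) y) (x y : R) : x * y = y * x := by
  rcases finite_or_infinite (Subring.center R) with hfin | hinf
  · exact mul_comm_of_pow_mem_center_of_finite hm h x y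
  obtain ⟨p, hchar⟩ := CharP.exists R
  rcases CharP.char_is_prime_or_zero R p with hp | rfl
  · have : Fact p.Prime := ⟨hp⟩
    obtain ⟨k, N, hN, rfl⟩ := Nat.exists_eq_pow_mul_and_not_dvd hm.ne' p hp.ne_one
    refine mul_comm_of_pow_char_pow_mem_center p k (fun x y => ?_) x y
    have hcharZ : CharP (Subring.center R) p :=
      (RingHom.charP_iff (Subring.center R).subtype Subtype.val_injective p).mpr hchar
    have hinj : Function.Injective fun t : Subring.center R => t ^ p ^ k :=
      iterateFrobenius_inj (Subring.center R) p k
    have key := nsmul_commutator_eq_zero (Set.infinite_range_of_injective hinj) (N := N)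
      (x := x ^ p ^ k) (y := y) (by
        rintro _ ⟨t, rfl⟩
        have hxt : Commute x t := Subring.mem_center_iff.mp t.2 x
        rw [Subring.coe_pow, ← add_pow_char_pow_of_commute p k hxt, ← pow_mul]
        exact h _ _)
    refine sub_eq_zero.mp ((mul_eq_zero.mp key).resolve_left ?_)
    exact fun h0 => hN ((CharP.cast_eq_zero_iff R p N).mp h0)
  · have : CharZero R := CharP.charP_to_charZero R
    have key := nsmul_commutator_eq_zero (Set.infinite_univ (α := Subring.center R)) (N := m)
      (x := x) (y := y) fun t _ => h _ _
    exact sub_eq_zero.mp ((mul_eq_zero.mp key).resolve_left (Nat.cast_ne_zero.mpr hm.ne'))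

/-- Let `R` be a prime ring, `I` a nonzero two-sided ideal of `R`, and `n` a positive
integer.  If `[x^n, y^n] ∈ Z(R)` for all `x, y ∈ I`, then `R` is commutative. -/
theorem stmt_1 {R : Type*} [Ring R]
    (hprime : ∀ a b : R, (∀ r : R, a * r * b = 0) → a = 0 ∨ b = 0)
    (I : TwoSidedIdeal R) (hI : ∃ x : R, x ∈ I ∧ x ≠ 0)
    (n : ℕ) (hn : 0 < n)
    (h : ∀ x ∈ I, ∀ y ∈ I, x ^ n * y ^ n - y ^ n * x ^ n ∈ Set.center R) :
    ∀ x y : R, x * y = y * x := by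
  have hm : 0 < 2 * n := by omega
  have hcomm := pow_two_mul_comm_of_commutator_mem_center hprime I h
  have : NoZeroDivisors R := ⟨eq_zero_or_eq_zero_of_mul_eq_zero_of_reduced hprime fun _ =>
    eq_zero_of_sq_eq_zero_of_pow_comm hprime I hI hm hcomm⟩
  have : Nontrivial R := ⟨hI.imp fun _ hx => ⟨0, hx.2⟩⟩
  have : IsDomain R := NoZeroDivisors.to_isDomain R
  exact mul_comm_of_pow_mem_center hm (pow_mem_center_of_pow_comm I hI hm hcomm)
end

section
/- Let R be a prime ring, I a nonzero (two-sided) ideal of R, and n ≥ 2 a fixed integer. Suppose F : R → R is a multiplicative (generalized)-derivation associated with a multiplicative derivation δ of R such that F acts as an n-homomorphism on I. Then δ = 0, and either F = 0, or F(x)y = xF(y) for all x, y ∈ R and the (n−1)-fold iterate of F is the identity map on R. -/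
section PrimeRing

variable {R : Type*} [Ring R]

/-- In a prime ring, a nonzero ideal can be placed between two factors to detect
that one of them vanishes. -/
theorem eq_zero_or_eq_zero_of_mul_ideal_mul
    (hprime : ∀ a b : R, (∀ r : R, a * r * b = 0) → a = 0 ∨ b = 0)
    {I : TwoSidedIdeal R} (hI : ∃ x : R, x ∈ I ∧ x ≠ 0) {c b : R}
    (h : ∀ x ∈ I, c * x * b = 0) : c = 0 ∨ b = 0 := by
  obtain ⟨z, hz, hz0⟩ := hI
  by_contra! hcb
  have key : ∀ s : R, z * s * b = 0 := fun s =>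
    (hprime c (z * s * b) fun r => by
      simpa [mul_assoc] using
        h (r * z * s) (I.mul_mem_right _ _ (I.mul_mem_left _ _ hz))).resolve_left hcb.1
  exact (hprime z b key).elim hz0 hcb.2

theorem eq_zero_of_mul_prod_map_mul_left
    (hprime : ∀ a b : R, (∀ r : R, a * r * b = 0) → a = 0 ∨ b = 0)
    {I : TwoSidedIdeal R} (hI : ∃ x : R, x ∈ I ∧ x ≠ 0) {a : R} (ha : a ≠ 0) (k : ℕ) {c : R}
    (h : ∀ x ∈ I, ∀ l : List R, l.length = k → (∀ y ∈ l, y ∈ I) →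
      c * x * (l.map (a * ·)).prod = 0) : c = 0 := by
  induction k generalizing c with
  | zero =>
    have h1 : (1 : R) ≠ 0 := fun h10 => ha (by rw [← mul_one a, h10, mul_zero])
    refine (eq_zero_or_eq_zero_of_mul_ideal_mul hprime hI (b := 1) fun x hx => ?_).resolve_right h1
    simpa using h x hx [] rfl (by simp)
  | succ k ih =>
    refine (eq_zero_or_eq_zero_of_mul_ideal_mul hprime hI fun x hx => ?_).resolve_right ha
    refine ih fun y hy l hl hlI => ?_
    simpa [mul_assoc] using h x hx (y :: l) (by simp [hl]) (by simpa using ⟨hy, hlI⟩)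

theorem multiplicative_derivation_eq_zero_of_nhom
    (hprime : ∀ a b : R, (∀ r : R, a * r * b = 0) → a = 0 ∨ b = 0)
    {I : TwoSidedIdeal R} (hI : ∃ x : R, x ∈ I ∧ x ≠ 0) (m : ℕ) {F δ : R → R}
    (hF : ∀ x y : R, F (x * y) = F x * y + x * δ y)
    (hnhom : ∀ l : List R, l.length = m + 2 → (∀ x ∈ l, x ∈ I) →
      F l.prod = (l.map F).prod) : δ = 0 := by
  funext y
  by_contra hy
  have hF_snoc : ∀ l : List R, l.length = m + 1 → (∀ x ∈ l, x ∈ I) → ∀ x ∈ I,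
      F (l.prod * x) = (l.map F).prod * F x := fun l hl hlI x hx => by
    simpa using hnhom (l ++ [x]) (by simp [hl]) (by
      simp only [List.mem_append, List.mem_singleton]
      rintro z (hz | rfl)
      exacts [hlI z hz, hx])
  have hprod : ∀ l : List R, l.length = m + 1 → (∀ x ∈ l, x ∈ I) →
      l.prod = (l.map F).prod := fun l hl hlI => by
    refine sub_eq_zero.1 ((eq_zero_or_eq_zero_of_mul_ideal_mul hprime hI
      fun x hx => ?_).resolve_right hy)
    have h1 := hF_snoc l hl hlI (x * y) (I.mul_mem_right _ _ hx)
    rw [← mul_assoc, hF, hF_snoc l hl hlI x hx, hF, mul_add, ← mul_assoc, ← mul_assoc] at h1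
    rw [sub_mul, sub_mul, sub_eq_zero]
    exact add_left_cancel h1
  have hprod_snoc : ∀ l : List R, l.length = m → (∀ x ∈ l, x ∈ I) → ∀ x ∈ I,
      l.prod * x = (l.map F).prod * F x := fun l hl hlI x hx => by
    simpa using hprod (l ++ [x]) (by simp [hl]) (by
      simp only [List.mem_append, List.mem_singleton]
      rintro z (hz | rfl)
      exacts [hlI z hz, hx])
  have hmap : ∀ l : List R, l.length = m → (∀ x ∈ l, x ∈ I) →
      (l.map F).prod = 0 := fun l hl hlI => by
    refine (eq_zero_or_eq_zero_of_mul_ideal_mul hprime hI fun x hx => ?_).resolve_right hy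
    have h1 := hprod_snoc l hl hlI (x * y) (I.mul_mem_right _ _ hx)
    rw [← mul_assoc, hprod_snoc l hl hlI x hx, hF, mul_add, ← mul_assoc, ← mul_assoc] at h1
    simpa using h1
  have h1 : (1 : R) ≠ 0 := fun h10 => hy (by rw [← mul_one (δ y), h10, mul_zero]; rfl)
  refine h1 (eq_zero_of_mul_prod_map_mul_left hprime hI h1 m fun x hx l hl hlI => ?_)
  have h2 := hprod (x :: l) (by simp [hl]) (by simpa using ⟨hx, hlI⟩)
  simpa [hmap l hl hlI] using h2

theorem prod_map_mul_left_of_commute {a : R} (ha : ∀ r : R, a * r = r * a) (l : List R) :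
    (l.map (a * ·)).prod = a ^ l.length * l.prod := by
  induction l with
  | nil => simp
  | cons x l ih =>
    have h : x * a ^ l.length = a ^ l.length * x :=
      ((show Commute a x from ha x).pow_left l.length).eq.symm
    rw [List.map_cons, List.prod_cons, ih, List.prod_cons, List.length_cons, pow_succ', mul_assoc,
      ← mul_assoc x, h]
    simp only [mul_assoc]

theorem mul_left_nhom_commute_and_pow_eq_one
    (hprime : ∀ a b : R, (∀ r : R, a * r * b = 0) → a = 0 ∨ b = 0)
    {I : TwoSidedIdeal R} (hI : ∃ x : R, x ∈ I ∧ x ≠ 0) (m : ℕ) {a : R} (ha : a ≠ 0)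
    (hnhom : ∀ l : List R, l.length = m + 2 → (∀ x ∈ l, x ∈ I) →
      a * l.prod = (l.map (a * ·)).prod) :
    (∀ r : R, a * r = r * a) ∧ a ^ (m + 1) = 1 := by
  have hcomm : ∀ r : R, a * r = r * a := fun r => by
    refine sub_eq_zero.1 ((eq_zero_or_eq_zero_of_mul_ideal_mul hprime hI
      fun x hx => ?_).resolve_left ha)
    refine eq_zero_of_mul_prod_map_mul_left hprime hI ha m fun y hy l hl hlI => ?_
    have h1 := hnhom (x :: (r * y) :: l) (by simp [hl])
      (by simpa using ⟨hx, I.mul_mem_left _ _ hy, hlI⟩)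
    have h2 := hnhom ((x * r) :: y :: l) (by simp [hl])
      (by simpa using ⟨I.mul_mem_right _ _ hx, hy, hlI⟩)
    simp only [List.prod_cons, List.map_cons, mul_assoc] at h1 h2
    simp only [mul_sub, sub_mul, mul_assoc]
    rw [← h1, ← h2, sub_self]
  refine ⟨hcomm, (sub_eq_zero.1 ((hprime a (a ^ (m + 1) - 1) fun r => ?_).resolve_left ha))⟩
  have h1 : (1 : R) ≠ 0 := fun h10 => ha (by rw [← mul_one a, h10, mul_zero])
  have hpow : a ^ (m + 2) - a = 0 := by
    refine eq_zero_of_mul_prod_map_mul_left hprime hI h1 (m + 1) fun x hx l hl hlI => ?_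
    have h2 := hnhom (x :: l) (by simp [hl]) (by simpa using ⟨hx, hlI⟩)
    rw [prod_map_mul_left_of_commute hcomm, List.length_cons, hl] at h2
    simp only [List.prod_cons] at h2
    simp [mul_assoc, sub_mul, h2]
  rw [hcomm r, mul_assoc, mul_sub, mul_one, ← pow_succ', hpow, mul_zero]

end PrimeRing

/-- Let `R` be a prime ring, `I` a nonzero two-sided ideal, `n ≥ 2`.  If `F` is a
multiplicative (generalized)-derivation associated with a multiplicative derivation `δ`
acting as an `n`-homomorphism on `I`, then `δ = 0`, and either `F = 0` or
`F(x)y = xF(y)` for all `x, y` and the `(n-1)`-fold iterate of `F` is the identity. -/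
theorem stmt_3 {R : Type*} [Ring R]
    (hprime : ∀ a b : R, (∀ r : R, a * r * b = 0) → a = 0 ∨ b = 0)
    (I : TwoSidedIdeal R) (hI : ∃ x : R, x ∈ I ∧ x ≠ 0)
    (n : ℕ) (hn : 2 ≤ n)
    (F δ : R → R)
    (hδ : ∀ x y : R, δ (x * y) = δ x * y + x * δ y)
    (hF : ∀ x y : R, F (x * y) = F x * y + x * δ y)
    (hnhom : ∀ l : List R, l.length = n → (∀ x ∈ l, x ∈ I) →
      F l.prod = (l.map F).prod) :
    δ = 0 ∧ (F = 0 ∨ ((∀ x y : R, F x * y = x * F y) ∧ F^[n - 1] = id)) := by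
  obtain ⟨m, rfl⟩ := Nat.exists_eq_add_of_le' hn
  have hδ0 : δ = 0 := multiplicative_derivation_eq_zero_of_nhom hprime hI m hF hnhom
  refine ⟨hδ0, ?_⟩
  have hFmul : F = (F 1 * ·) := funext fun x => by simpa [hδ0] using hF 1 x
  generalize F 1 = a at hFmul
  subst hFmul
  by_cases ha : a = 0
  · exact Or.inl (funext fun x => by simp [ha])
  · obtain ⟨hcomm, hpow⟩ := mul_left_nhom_commute_and_pow_eq_one hprime hI m ha hnhom
    refine Or.inr ⟨fun x y => by simp only [hcomm x, mul_assoc], ?_⟩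
    rw [mul_left_iterate, show m + 2 - 1 = m + 1 from rfl, hpow]
    exact funext one_mul
end

section
/- Let R be a prime ring, I a nonzero (two-sided) ideal of R, and n ≥ 2 a fixed integer. Suppose F : R → R is a multiplicative (generalized)-derivation associated with a multiplicative derivation δ of R such that F acts as an n-homomorphism on I. Then δ = 0. -/
/-- In a prime ring, a nonzero ideal between two elements detects vanishing of their product. -/
theorem eq_zero_or_eq_zero_of_forall_mem_mul {R : Type*} [Ring R]
    (hprime : ∀ a b : R, (∀ r : R, a * r * b = 0) → a = 0 ∨ b = 0)
    (I : TwoSidedIdeal R) (hI : ∃ x : R, x ∈ I ∧ x ≠ 0) {a b : R}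
    (h : ∀ x ∈ I, a * x * b = 0) : a = 0 ∨ b = 0 := by
  obtain ⟨w, hw, hw0⟩ := hI
  by_contra! hab
  refine hw0 ((hprime w b fun s => ?_).resolve_right hab.2)
  refine (hprime a (w * s * b) fun r => ?_).resolve_left hab.1
  simpa only [mul_assoc] using h (r * (w * s)) (I.mul_mem_left _ _ (I.mul_mem_right _ _ hw))

/-- If all products of `k` values on `I` of a multiplicative (generalized)-derivation vanish,
then its associated map takes only the value `0`, or the ring is trivial. -/
theorem eq_zero_of_forall_prod_map_eq_zero {R : Type*} [Ring R]
    (hprime : ∀ a b : R, (∀ r : R, a * r * b = 0) → a = 0 ∨ b = 0)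
    (I : TwoSidedIdeal R) (hI : ∃ x : R, x ∈ I ∧ x ≠ 0) {F δ : R → R}
    (hF : ∀ x y : R, F (x * y) = F x * y + x * δ y) (z : R) (k : ℕ)
    (h : ∀ l : List R, l.length = k → (∀ x ∈ l, x ∈ I) → (l.map F).prod = 0) : δ z = 0 := by
  induction k with
  | zero =>
    have h1 : (1 : R) = 0 := by simpa using h [] rfl (by simp)
    rw [← mul_one (δ z), h1, mul_zero]
  | succ k ih =>
    by_contra hz
    refine hz (ih fun l hl hlI => ?_)
    refine (eq_zero_or_eq_zero_of_forall_mem_mul hprime I hI fun x hx => ?_).resolve_right hz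
    have hx' := h (l ++ [x]) (by simp [hl]) (by simp_all [or_imp])
    have hxz := h (l ++ [x * z]) (by simp [hl])
      (by have := I.mul_mem_right x z hx; simp_all [or_imp])
    simp only [List.map_append, List.map_cons, List.map_nil, List.prod_append,
      List.prod_singleton] at hx' hxz
    rwa [hF, mul_add, ← mul_assoc, hx', zero_mul, zero_add, ← mul_assoc] at hxz


/-- Let `R` be a prime ring, `I` a nonzero two-sided ideal, `n ≥ 2`.  If `F` is a
multiplicative (generalized)-derivation associated with a multiplicative derivation `δ`
acting as an `n`-homomorphism on `I`, then `δ = 0`. -/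
theorem stmt_4 {R : Type*} [Ring R]
    (hprime : ∀ a b : R, (∀ r : R, a * r * b = 0) → a = 0 ∨ b = 0)
    (I : TwoSidedIdeal R) (hI : ∃ x : R, x ∈ I ∧ x ≠ 0)
    (n : ℕ) (hn : 2 ≤ n)
    (F δ : R → R)
    (hδ : ∀ x y : R, δ (x * y) = δ x * y + x * δ y)
    (hF : ∀ x y : R, F (x * y) = F x * y + x * δ y)
    (hnhom : ∀ l : List R, l.length = n → (∀ x ∈ l, x ∈ I) →
      F l.prod = (l.map F).prod) :
    δ = 0 := by
  obtain ⟨k, rfl⟩ := Nat.exists_eq_add_of_le' hn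
  funext z
  by_contra hz
  have hz : δ z ≠ 0 := hz
  have key : ∀ l : List R, l.length = k + 1 → (∀ x ∈ l, x ∈ I) → (l.map F).prod = l.prod := by
    intro l hl hlI
    rw [← sub_eq_zero]
    refine (eq_zero_or_eq_zero_of_forall_mem_mul hprime I hI fun x hx => ?_).resolve_right hz
    have hx' := hnhom (l ++ [x]) (by simp [hl]) (by simp_all [or_imp])
    have hxz := hnhom (l ++ [x * z]) (by simp [hl])
      (by have := I.mul_mem_right x z hx; simp_all [or_imp])
    simp only [List.map_append, List.map_cons, List.map_nil, List.prod_append,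
      List.prod_singleton] at hx' hxz
    rw [← mul_assoc, hF (l.prod * x), hF x, hx', mul_add, ← mul_assoc, add_right_inj] at hxz
    rw [sub_mul, sub_mul, hxz, mul_assoc _ x, sub_self]
  refine hz (eq_zero_of_forall_prod_map_eq_zero hprime I hI hF z k fun l hl hlI => ?_)
  refine (eq_zero_or_eq_zero_of_forall_mem_mul hprime I hI fun x hx => ?_).resolve_right hz
  have hx' := key (l ++ [x]) (by simp [hl]) (by simp_all [or_imp])
  have hxz := key (l ++ [x * z]) (by simp [hl])
    (by have := I.mul_mem_right x z hx; simp_all [or_imp])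
  simp only [List.map_append, List.map_cons, List.map_nil, List.prod_append,
    List.prod_singleton] at hx' hxz
  rwa [hF, mul_add, ← mul_assoc, hx', ← mul_assoc l.prod, add_eq_left, ← mul_assoc] at hxz
end

section
/- Let R be a prime ring, I a nonzero (two-sided) ideal of R, and n ≥ 2 a fixed integer. Suppose F : R → R is a map satisfying F(xy) = F(x)y for all x, y ∈ R (i.e., F is a multiplicative (generalized)-derivation with associated derivation δ = 0) and F acts as an n-homomorphism on I. Then either F = 0, or F(r)s = rF(s) for all r, s ∈ R. -/
theorem TwoSidedIdeal.eq_zero_of_mul_mul_eq_zero {R : Type*} [Ring R]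
    (hprime : ∀ a b : R, (∀ r : R, a * r * b = 0) → a = 0 ∨ b = 0)
    (I : TwoSidedIdeal R) (hI : ∃ x : R, x ∈ I ∧ x ≠ 0) {a b : R} (ha : a ≠ 0)
    (h : ∀ x ∈ I, a * x * b = 0) : b = 0 := by
  obtain ⟨x, hx, hx0⟩ := hI
  refine (hprime x b fun s => ?_).resolve_left hx0
  refine (hprime a (x * s * b) fun r => ?_).resolve_left ha
  simpa only [mul_assoc] using h (r * (x * s)) (I.mul_mem_left r _ (I.mul_mem_right x s hx))

theorem TwoSidedIdeal.eq_zero_of_prod_map_mul_eq_zero {R : Type*} [Ring R]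
    (hprime : ∀ a b : R, (∀ r : R, a * r * b = 0) → a = 0 ∨ b = 0)
    (I : TwoSidedIdeal R) (hI : ∃ x : R, x ∈ I ∧ x ≠ 0) {q c : R} (hq : q ≠ 0) (m : ℕ)
    (h : ∀ l : List R, l.length = m → (∀ x ∈ l, x ∈ I) → (l.map (q * ·)).prod * c = 0) :
    c = 0 := by
  induction m with
  | zero => simpa using h [] rfl (by simp)
  | succ m ih =>
    refine ih fun l hl hlI => I.eq_zero_of_mul_mul_eq_zero hprime hI hq fun x hx => ?_
    simpa [mul_assoc] using h (x :: l) (by simp [hl]) (by simpa using ⟨hx, hlI⟩)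


/-- Let `R` be a prime ring, `I` a nonzero two-sided ideal, `n ≥ 2`.  If `F : R → R`
satisfies `F(xy) = F(x)y` for all `x, y ∈ R` and acts as an `n`-homomorphism on `I`,
then either `F = 0` or `F(r)s = rF(s)` for all `r, s ∈ R`. -/
theorem stmt_5 {R : Type*} [Ring R]
    (hprime : ∀ a b : R, (∀ r : R, a * r * b = 0) → a = 0 ∨ b = 0)
    (I : TwoSidedIdeal R) (hI : ∃ x : R, x ∈ I ∧ x ≠ 0)
    (n : ℕ) (hn : 2 ≤ n)
    (F : R → R)
    (hF : ∀ x y : R, F (x * y) = F x * y)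
    (hnhom : ∀ l : List R, l.length = n → (∀ x ∈ l, x ∈ I) →
      F l.prod = (l.map F).prod) :
    F = 0 ∨ ∀ r s : R, F r * s = r * F s := by
  have hFq : F = (F 1 * ·) := funext fun x => by simpa using hF 1 x
  generalize F 1 = q at hFq
  subst hFq
  by_cases hq : q = 0
  · left
    funext x
    simp [hq]
  right
  obtain ⟨m, rfl⟩ := Nat.exists_eq_add_of_le' hn
  have : Nontrivial R := ⟨⟨q, 0, hq⟩⟩
  have hcancel : ∀ l : List R, l.length = m → (∀ x ∈ l, x ∈ I) →
      l.prod = (l.map (q * ·)).prod * q := by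
    intro l hl hlI
    obtain ⟨z, hz, hz0⟩ := hI
    rw [← sub_eq_zero]
    refine (hprime _ z fun r => ?_).resolve_right hz0
    have hrz : r * z ∈ I := I.mul_mem_left r z hz
    rw [mul_assoc]
    refine I.eq_zero_of_mul_mul_eq_zero hprime ⟨z, hz, hz0⟩ hq fun x hx => ?_
    have h := hnhom (x :: (l ++ [r * z])) (by simp [hl]) (by
      intro y hy
      simp only [List.mem_cons, List.mem_append, List.not_mem_nil, or_false] at hy
      rcases hy with rfl | hy | rfl
      exacts [hx, hlI y hy, hrz])
    simp only [List.prod_cons, List.prod_append, List.map_cons, List.map_append, List.map_nil,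
      List.prod_nil, mul_one] at h
    rw [sub_mul, mul_sub, sub_eq_zero]
    simpa only [mul_assoc] using h
  have hcomm : ∀ r : R, q * r = r * q := by
    intro r
    cases m with
    | zero =>
      have h1 : 1 = q := by simpa using hcancel [] rfl (by simp)
      simp [← h1]
    | succ m =>
      rw [← sub_eq_zero]
      refine I.eq_zero_of_prod_map_mul_eq_zero hprime hI hq (m + 1) fun l hl hlI => ?_
      obtain ⟨l, x, rfl⟩ := (List.eq_nil_or_concat' l).resolve_left (by rintro rfl; simp at hl)
      have hx : x ∈ I := hlI x (by simp)
      have h1 := hcancel (l ++ [x]) hl hlI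
      have h2 := hcancel (l ++ [x * r]) (by simpa using hl) (by
        intro y hy
        simp only [List.mem_append, List.mem_singleton] at hy
        rcases hy with hy | rfl
        exacts [hlI y (by simp [hy]), I.mul_mem_right x r hx])
      simp only [List.prod_append, List.prod_singleton, List.map_append, List.map_cons,
        List.map_nil] at h1 h2 ⊢
      rw [mul_sub, sub_eq_zero, ← mul_assoc, ← h1, mul_assoc, h2]
      simp only [mul_assoc]
  intro r s
  change q * r * s = r * (q * s)
  rw [hcomm, mul_assoc]
end

section
/- Let R be a prime ring and I a nonzero (two-sided) ideal of R. Suppose F : R → R is a multiplicative (generalized)-derivation associated with a multiplicative derivation δ of R such that F acts as a homomorphism on I, i.e., F(xy) = F(x)F(y) for all x, y ∈ I. Then δ = 0, and either F = 0 or F(x) = x for all x ∈ R. -/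
/-- In a prime ring, `a * I = 0` for a nonzero two-sided ideal `I` forces `a = 0`. -/
theorem eq_zero_of_forall_mul_mem_eq_zero {R : Type*} [Ring R]
    (hprime : ∀ a b : R, (∀ r : R, a * r * b = 0) → a = 0 ∨ b = 0)
    {I : TwoSidedIdeal R} (hI : ∃ x : R, x ∈ I ∧ x ≠ 0) {a : R}
    (h : ∀ x ∈ I, a * x = 0) : a = 0 := by
  obtain ⟨c, hc, hc0⟩ := hI
  refine (hprime a c fun r => ?_).resolve_right hc0
  rw [mul_assoc]
  exact h _ (I.mul_mem_left r c hc)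

/-- In a prime ring, `a * I * b = 0` for a nonzero two-sided ideal `I` forces `a = 0` or `b = 0`. -/
theorem eq_zero_or_eq_zero_of_forall_mem_mul_mul_eq_zero {R : Type*} [Ring R]
    (hprime : ∀ a b : R, (∀ r : R, a * r * b = 0) → a = 0 ∨ b = 0)
    {I : TwoSidedIdeal R} (hI : ∃ x : R, x ∈ I ∧ x ≠ 0) {a b : R}
    (h : ∀ x ∈ I, a * x * b = 0) : a = 0 ∨ b = 0 := by
  by_cases hb : b = 0
  · exact Or.inr hb
  refine Or.inl (eq_zero_of_forall_mul_mem_eq_zero hprime hI fun x hx => ?_)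
  refine (hprime (a * x) b fun r => ?_).resolve_right hb
  simpa only [mul_assoc] using h (x * r) (I.mul_mem_right x r hx)

/-- Let `R` be a prime ring and `I` a nonzero two-sided ideal.  If `F` is a
multiplicative (generalized)-derivation associated with a multiplicative derivation `δ`
acting as a homomorphism on `I`, then `δ = 0`, and `F = 0` or `F(x) = x` for all `x`. -/
theorem stmt_6 {R : Type*} [Ring R]
    (hprime : ∀ a b : R, (∀ r : R, a * r * b = 0) → a = 0 ∨ b = 0)
    (I : TwoSidedIdeal R) (hI : ∃ x : R, x ∈ I ∧ x ≠ 0)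
    (F δ : R → R)
    (hδ : ∀ x y : R, δ (x * y) = δ x * y + x * δ y)
    (hF : ∀ x y : R, F (x * y) = F x * y + x * δ y)
    (hhom : ∀ x ∈ I, ∀ y ∈ I, F (x * y) = F x * F y) :
    δ = 0 ∧ (F = 0 ∨ ∀ x : R, F x = x) := by
  have hzero {a : R} (h : ∀ x ∈ I, a * x = 0) : a = 0 :=
    eq_zero_of_forall_mul_mem_eq_zero hprime hI h
  have hδI : ∀ z ∈ I, δ z = 0 := by
    intro z hz
    by_contra hne
    have hid : ∀ x ∈ I, F x = x := by
      intro x hx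
      refine sub_eq_zero.mp ((eq_zero_or_eq_zero_of_forall_mem_mul_mul_eq_zero hprime hI
        fun y hy => ?_).resolve_right hne)
      have h₁ := hhom x hx (y * z) (I.mul_mem_right y z hy)
      rw [← mul_assoc, hF, hhom x hx y hy, hF, mul_add, mul_assoc (F x) (F y) z] at h₁
      rw [sub_mul, sub_mul, mul_assoc (F x), ← add_left_cancel h₁, sub_self]
    obtain ⟨c, hc, hc0⟩ := hI
    refine hne ((hprime c (δ z) fun r => ?_).resolve_left hc0)
    have hcr := I.mul_mem_right c r hc
    have h := hF (c * r) z
    rw [hid _ (I.mul_mem_right _ z hcr), hid _ hcr] at h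
    exact left_eq_add.mp h
  have hδ0 : ∀ r, δ r = 0 := fun r => hzero fun x hx => by
    have h := hδ r x
    rw [hδI _ (I.mul_mem_left r x hx), hδI x hx, mul_zero, add_zero] at h
    exact h.symm
  have hmul : ∀ x y, F (x * y) = F x * y := fun x y => by
    rw [hF, hδ0, mul_zero, add_zero]
  refine ⟨funext hδ0, ?_⟩
  by_cases hid : ∀ y ∈ I, F y = y
  · refine Or.inr fun r => sub_eq_zero.mp (hzero fun x hx => ?_)
    rw [sub_mul, ← hmul, hid _ (I.mul_mem_left r x hx), sub_self]
  · push Not at hid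
    obtain ⟨y, hy, hne⟩ := hid
    have hFI : ∀ x ∈ I, F x = 0 := fun x hx =>
      (hprime (F x) (F y - y) fun r => by
        rw [← hmul, mul_sub, ← hhom _ (I.mul_mem_right x r hx) y hy, hmul, sub_self]).resolve_right
        (sub_ne_zero.mpr hne)
    refine Or.inl (funext fun r => hzero fun x hx => ?_)
    rw [← hmul, hFI _ (I.mul_mem_left r x hx)]
end

section
/- Let R be a prime ring, I a nonzero (two-sided) ideal of R, and n ≥ 2 a fixed integer. Suppose F : R → R is a multiplicative (generalized)-derivation associated with a multiplicative derivation δ of R such that F acts as an n-antihomomorphism on I. Then F(y)^{n−1} x δ(y) = x y^{n−1} δ(y) for all x, y ∈ I. -/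
/-- Let `R` be a prime ring, `I` a nonzero two-sided ideal, `n ≥ 2`.  If `F` is a
multiplicative (generalized)-derivation associated with `δ` acting as an
`n`-antihomomorphism on `I`, then `F(y)^(n-1) x δ(y) = x y^(n-1) δ(y)` for `x, y ∈ I`. -/
theorem stmt_7 {R : Type*} [Ring R]
    (hprime : ∀ a b : R, (∀ r : R, a * r * b = 0) → a = 0 ∨ b = 0)
    (I : TwoSidedIdeal R) (hI : ∃ x : R, x ∈ I ∧ x ≠ 0)
    (n : ℕ) (hn : 2 ≤ n)
    (F δ : R → R)
    (hδ : ∀ x y : R, δ (x * y) = δ x * y + x * δ y)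
    (hF : ∀ x y : R, F (x * y) = F x * y + x * δ y)
    (hnanti : ∀ l : List R, l.length = n → (∀ x ∈ l, x ∈ I) →
      F l.prod = (l.reverse.map F).prod) :
    ∀ x ∈ I, ∀ y ∈ I, F y ^ (n - 1) * x * δ y = x * y ^ (n - 1) * δ y := by
  obtain ⟨m, rfl⟩ : ∃ m, n = m + 1 := ⟨n - 1, by omega⟩
  intro x hx y hy
  simp only [Nat.add_sub_cancel]
  have anti : ∀ z ∈ I, F (z * y ^ m) = F y ^ m * F z := by
    intro z hz
    have h := hnanti (z :: List.replicate m y) (by simp) (by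
      intro w hw
      rcases List.mem_cons.1 hw with rfl | hw
      · exact hz
      · rwa [List.eq_of_mem_replicate hw])
    simpa using h
  have h₁ := anti (x * y) (I.mul_mem_left x y hy)
  have h₂ := hF (x * y ^ m) y
  rw [hF x y, mul_assoc x y, ← pow_succ', pow_succ, ← mul_assoc x, h₂, anti x hx,
    mul_add, ← mul_assoc, ← mul_assoc] at h₁
  exact (add_left_cancel h₁).symm
end

section
/- Let R be a prime ring, I a nonzero (two-sided) ideal of R, and n ≥ 2 a fixed integer. Suppose F : R → R is a multiplicative (generalized)-derivation associated with a multiplicative derivation δ of R such that F acts as an n-antihomomorphism on I. Then [F(y)^{n−1}, r] x δ(y) = 0 for all x, y ∈ I and all r ∈ R. -/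
/-- Let `R` be a prime ring, `I` a nonzero two-sided ideal, `n ≥ 2`.  If `F` is a
multiplicative (generalized)-derivation associated with `δ` acting as an
`n`-antihomomorphism on `I`, then `[F(y)^(n-1), r] x δ(y) = 0` for all
`x, y ∈ I`, `r ∈ R`. -/
theorem stmt_8 {R : Type*} [Ring R]
    (hprime : ∀ a b : R, (∀ r : R, a * r * b = 0) → a = 0 ∨ b = 0)
    (I : TwoSidedIdeal R) (hI : ∃ x : R, x ∈ I ∧ x ≠ 0)
    (n : ℕ) (hn : 2 ≤ n)
    (F δ : R → R)
    (hδ : ∀ x y : R, δ (x * y) = δ x * y + x * δ y)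
    (hF : ∀ x y : R, F (x * y) = F x * y + x * δ y)
    (hnanti : ∀ l : List R, l.length = n → (∀ x ∈ l, x ∈ I) →
      F l.prod = (l.reverse.map F).prod) :
    ∀ x ∈ I, ∀ y ∈ I, ∀ r : R,
      (F y ^ (n - 1) * r - r * F y ^ (n - 1)) * x * δ y = 0 := by
  have power_left : ∀ x ∈ I, ∀ y ∈ I, F (x * y ^ (n - 1)) = F y ^ (n - 1) * F x := by
    intro x hx y hy
    have h := hnanti (x :: List.replicate (n - 1) y) (by simp; omega) (by
      intro z hz
      rcases List.mem_cons.1 hz with rfl | hz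
      · exact hx
      · rwa [List.eq_of_mem_replicate hz])
    simpa using h
  have swap : ∀ x ∈ I, ∀ y ∈ I, F y ^ (n - 1) * x * δ y = x * y ^ (n - 1) * δ y := by
    intro x hx y hy
    have h₁ := power_left (x * y) (I.mul_mem_right x y hx) y hy
    have h₂ := hF (x * y ^ (n - 1)) y
    rw [mul_assoc x, ← pow_succ, pow_succ', ← mul_assoc x, h₁, hF x y,
      power_left x hx y hy, mul_add, ← mul_assoc, ← mul_assoc] at h₂
    exact add_left_cancel h₂
  intro x hx y hy r
  have h₁ := swap (r * x) (I.mul_mem_left r x hx) y hy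
  have h₂ := congrArg (r * ·) (swap x hx y hy)
  simp only [sub_mul, mul_assoc] at h₁ h₂ ⊢
  rw [h₁, h₂, sub_self]
end

section
/- Let R be a prime ring, I a nonzero (two-sided) ideal of R, and n ≥ 2 a fixed integer. Suppose δ : R → R is a multiplicative derivation of R that is itself a multiplicative (generalized)-derivation associated with δ (i.e., F = δ) and δ acts as an n-antihomomorphism on I. Then δ(x)^{n−1} ∈ Z(R) for all x ∈ I. -/
/-- In a prime ring, `a * z * b = 0` for all `z` in a nonzero ideal forces `a = 0` or `b = 0`. -/
theorem eq_zero_or_eq_zero_of_forall_mem_mul_eq_zero {R : Type*} [Ring R]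
    (hprime : ∀ a b : R, (∀ r : R, a * r * b = 0) → a = 0 ∨ b = 0)
    (I : TwoSidedIdeal R) (hI : ∃ x : R, x ∈ I ∧ x ≠ 0) {a b : R}
    (h : ∀ z ∈ I, a * z * b = 0) : a = 0 ∨ b = 0 := by
  obtain ⟨u, hu, hu0⟩ := hI
  by_contra! hab
  have h₁ : ∀ r, a * r * u = 0 := by
    intro r
    refine (hprime (a * r * u) b fun s => ?_).resolve_right hab.2
    have := h (r * u * s) (I.mul_mem_right _ _ (I.mul_mem_left _ _ hu))
    simpa only [mul_assoc] using this
  exact (hprime a u h₁).elim hab.1 hu0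

/-- In a prime ring, an element commuting with a nonzero ideal is central. -/
theorem mem_center_of_forall_mem_commute {R : Type*} [Ring R]
    (hprime : ∀ a b : R, (∀ r : R, a * r * b = 0) → a = 0 ∨ b = 0)
    (I : TwoSidedIdeal R) (hI : ∃ x : R, x ∈ I ∧ x ≠ 0) {d : R}
    (h : ∀ y ∈ I, y * d = d * y) : d ∈ Set.center R := by
  obtain ⟨u, hu, hu0⟩ := hI
  rw [Semigroup.mem_center_iff]
  intro s
  refine sub_eq_zero.1 ((hprime u (s * d - d * s) fun r => ?_).resolve_left hu0)
  have h₁ := h (u * r) (I.mul_mem_right _ _ hu)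
  have h₂ := h (u * r * s) (I.mul_mem_right _ _ (I.mul_mem_right _ _ hu))
  rw [mul_sub, ← mul_assoc, ← mul_assoc, h₁, h₂, mul_assoc d, sub_self]

/-- Let `R` be a prime ring, `I` a nonzero two-sided ideal, `n ≥ 2`.  If `δ` is a
multiplicative derivation of `R` acting as an `n`-antihomomorphism on `I`
(i.e. `F = δ`), then `δ(x)^(n-1) ∈ Z(R)` for all `x ∈ I`. -/
theorem stmt_9 {R : Type*} [Ring R]
    (hprime : ∀ a b : R, (∀ r : R, a * r * b = 0) → a = 0 ∨ b = 0)
    (I : TwoSidedIdeal R) (hI : ∃ x : R, x ∈ I ∧ x ≠ 0)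
    (n : ℕ) (hn : 2 ≤ n)
    (δ : R → R)
    (hδ : ∀ x y : R, δ (x * y) = δ x * y + x * δ y)
    (hnanti : ∀ l : List R, l.length = n → (∀ x ∈ l, x ∈ I) →
      δ l.prod = (l.reverse.map δ).prod) :
    ∀ x ∈ I, δ x ^ (n - 1) ∈ Set.center R := by
  intro x hx
  obtain ⟨m, rfl⟩ : ∃ m, n = m + 1 := ⟨n - 1, by lia⟩
  rw [Nat.add_sub_cancel]
  have key : ∀ z ∈ I, δ (x ^ m * z) = δ z * δ x ^ m := by
    intro z hz
    have := hnanti (List.replicate m x ++ [z]) (by simp) (by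
      intro w hw
      rcases List.mem_append.1 hw with hw | hw
      · rwa [List.eq_of_mem_replicate hw]
      · rwa [List.mem_singleton.1 hw])
    simpa using this
  have expand : ∀ z ∈ I, ∀ y, (δ z * y + z * δ y) * δ x ^ m
      = δ z * δ x ^ m * y + x ^ m * z * δ y := by
    intro z hz y
    rw [← hδ, ← key _ (I.mul_mem_right _ _ hz), ← mul_assoc, hδ, key z hz]
  have annihilate : ∀ y, ∀ z ∈ I, δ x * z * (y * δ x ^ m - δ x ^ m * y) = 0 := by
    intro y z hz
    have h₁ := expand (x * z) (I.mul_mem_left _ _ hz) y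
    have h₂ := congrArg (x * ·) (expand z hz y)
    rw [hδ, ← mul_assoc (x ^ m), ← pow_succ, pow_succ'] at h₁
    simp only [mul_add, add_mul, mul_sub, mul_assoc] at h₁ h₂ ⊢
    rw [sub_eq_zero]
    grind
  by_cases h0 : δ x = 0
  · rw [h0, zero_pow (by lia)]
    exact Set.zero_mem_center
  · exact mem_center_of_forall_mem_commute hprime I hI fun y _ => sub_eq_zero.1 <|
      (eq_zero_or_eq_zero_of_forall_mem_mul_eq_zero hprime I hI (annihilate y)).resolve_left h0
end

section
/- Let R be a prime ring, I a nonzero (two-sided) ideal of R, and n ≥ 2 a fixed integer. Suppose F : R → R is a map satisfying F(xy) = F(x)y for all x, y ∈ R and F acts as an n-antihomomorphism on I. Then F(x₁)·[x₂x₃⋯xₙ, x_{n+1}] = 0 for all x₁, x₂, …, x_{n+1} ∈ I; consequently, either F = 0 or R is commutative. -/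
/-- In a prime ring, a nonzero ideal contains nonzero products of any length. -/
theorem exists_list_mem_prod_ne_zero {R : Type*} [Ring R]
    (hprime : ∀ a b : R, (∀ r : R, a * r * b = 0) → a = 0 ∨ b = 0)
    (I : TwoSidedIdeal R) {x : R} (hx : x ∈ I) (hx0 : x ≠ 0) (k : ℕ) :
    ∃ l : List R, l.length = k ∧ (∀ y ∈ l, y ∈ I) ∧ l.prod ≠ 0 := by
  induction k with
  | zero => exact ⟨[], rfl, by simp, fun h => hx0 (by simpa using congrArg (· * x) h)⟩
  | succ k ih =>
    obtain ⟨l, hl, hlI, hl0⟩ := ih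
    have : ∃ r : R, x * r * l.prod ≠ 0 := by
      by_contra! h
      exact (hprime _ _ h).elim hx0 hl0
    obtain ⟨r, hr⟩ := this
    refine ⟨x * r :: l, by simp [hl], ?_, by simpa using hr⟩
    simpa using ⟨I.mul_mem_right _ _ hx, hlI⟩

/-- In a prime ring, an element commuting with a nonzero ideal is central. -/
theorem commute_of_commute_ideal {R : Type*} [Ring R]
    (hprime : ∀ a b : R, (∀ r : R, a * r * b = 0) → a = 0 ∨ b = 0)
    (I : TwoSidedIdeal R) {x : R} (hx : x ∈ I) (hx0 : x ≠ 0) {p : R}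
    (hp : ∀ z ∈ I, p * z = z * p) (r : R) : p * r = r * p := by
  have h : ∀ s : R, x * s * (p * r - r * p) = 0 := fun s => by
    have hxs : x * s ∈ I := I.mul_mem_right _ _ hx
    rw [mul_sub, ← mul_assoc, ← mul_assoc, ← hp _ hxs, ← hp _ (I.mul_mem_right _ r hxs),
      mul_assoc, sub_self]
  exact sub_eq_zero.mp ((hprime _ _ h).resolve_left hx0)


/-- Let `R` be a prime ring, `I` a nonzero two-sided ideal, `n ≥ 2`.  If `F : R → R`
satisfies `F(xy) = F(x)y` for all `x, y ∈ R` and acts as an `n`-antihomomorphism on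
`I`, then `F(x₁)[x₂⋯xₙ, x_{n+1}] = 0` for all `x₁, …, x_{n+1} ∈ I`; consequently,
either `F = 0` or `R` is commutative. -/
theorem stmt_14 {R : Type*} [Ring R]
    (hprime : ∀ a b : R, (∀ r : R, a * r * b = 0) → a = 0 ∨ b = 0)
    (I : TwoSidedIdeal R) (hI : ∃ x : R, x ∈ I ∧ x ≠ 0)
    (n : ℕ) (hn : 2 ≤ n)
    (F : R → R)
    (hF : ∀ x y : R, F (x * y) = F x * y)
    (hnanti : ∀ l : List R, l.length = n → (∀ x ∈ l, x ∈ I) →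
      F l.prod = (l.reverse.map F).prod) :
    (∀ x₁ ∈ I, ∀ l : List R, l.length = n - 1 → (∀ x ∈ l, x ∈ I) → ∀ z ∈ I,
      F x₁ * (l.prod * z - z * l.prod) = 0) ∧
    (F = 0 ∨ ∀ a b : R, a * b = b * a) := by
  obtain ⟨x, hx, hx0⟩ := hI
  have key : ∀ x₁ ∈ I, ∀ l : List R, l.length = n - 1 → (∀ x ∈ l, x ∈ I) → ∀ z ∈ I,
      F x₁ * (l.prod * z - z * l.prod) = 0 := by
    intro x₁ hx₁ l hl hlI z hz
    have h₁ := hnanti (x₁ :: l) (by simp; omega) (by simpa using ⟨hx₁, hlI⟩)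
    have h₂ := hnanti (x₁ * z :: l) (by simp; omega)
      (by simpa using ⟨I.mul_mem_right _ _ hx₁, hlI⟩)
    simp only [List.prod_cons, List.reverse_cons, List.map_append, List.prod_append,
      List.map_cons, List.map_nil, List.prod_nil, mul_one, hF] at h₁ h₂
    rw [mul_sub, ← mul_assoc, ← mul_assoc, h₁, h₂, mul_assoc, sub_self]
  refine ⟨key, ?_⟩
  by_cases hFI : ∀ y ∈ I, F y = 0
  · left
    funext y
    refine (hprime (F y) x fun r => ?_).resolve_right hx0
    rw [mul_assoc, ← hF]
    exact hFI _ (I.mul_mem_left _ _ (I.mul_mem_left _ _ hx))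
  · right
    push Not at hFI
    obtain ⟨y, hy, hy0⟩ := hFI
    have central : ∀ l : List R, l.length = n - 1 → (∀ x ∈ l, x ∈ I) →
        ∀ r : R, l.prod * r = r * l.prod := fun l hl hlI =>
      commute_of_commute_ideal hprime I hx hx0 fun z hz => sub_eq_zero.mp <|
        (hprime _ _ fun r => by
          rw [← hF]
          exact key _ (I.mul_mem_right _ _ hy) l hl hlI z hz).resolve_left hy0
    obtain ⟨l, hl, hlI, hl0⟩ := exists_list_mem_prod_ne_zero hprime I hx hx0 (n - 1)
    intro a b
    have hcomm : (a * b - b * a) * l.prod = 0 := by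
      have hal : a * l.prod * b = b * (a * l.prod) := by
        cases l with
        | nil => simp at hl; omega
        | cons w t =>
          have hw : w ∈ I ∧ ∀ x ∈ t, x ∈ I := by simpa using hlI
          have := central (a * w :: t) (by simpa using hl)
            (by simpa using ⟨I.mul_mem_left _ _ hw.1, hw.2⟩) b
          simpa [mul_assoc] using this
      rw [mul_assoc, central l hl hlI b, ← mul_assoc] at hal
      rw [sub_mul, hal, mul_assoc, sub_self]
    refine sub_eq_zero.mp ((hprime _ _ fun r => ?_).resolve_right hl0)
    rw [mul_assoc, ← central l hl hlI r, ← mul_assoc, hcomm, zero_mul]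
end
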